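/- Let M be a non-negative, bounded, non-decreasing set function on the subsets of ℝ^d whose support supp(M) = {t ∈ ℝ^d : M(B(t,r)) > 0 for all r > 0} is non-empty and compact. Then the upper box dimension of supp(M) equals −τ_M(0), and for every h ≥ 0, dim_H {t ∈ supp(M) : liminf_{r→0+} log M(B(t,r)) / log r = h} ≤ τ_M^*(h) = inf_{q∈ℝ}(hq − τ_M(q)), where a negative right-hand side means that the set is empty. -/

import Mathlib

open Filter Set Metric Topology MeasureTheory
open scoped ENNReal NNReal
noncomputable section

/-- Support of a set function `M` on `ℝ^d`. -/
def suppM {d : ℕ} (M : Set (EuclideanSpace ℝ (Fin d)) → ℝ) : Set (EuclideanSpace ℝ (Fin d)) :=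
  {t | ∀ r : ℝ, 0 < r → 0 < M (ball t r)}

/-- `L^q`-spectrum of a set function `M`:
`τ_M(q) = liminf_{r→0+} log sup{Σ_i M(B_i)^q} / log r`, the supremum over all families of
disjoint closed balls of radius `r` with centers in `supp(M)`. -/
def tauM {d : ℕ} (M : Set (EuclideanSpace ℝ (Fin d)) → ℝ) (q : ℝ) : EReal :=
  liminf (fun r : ℝ =>
    ((Real.log (sSup {x : ℝ | ∃ S : Finset (EuclideanSpace ℝ (Fin d)),
        (↑S : Set (EuclideanSpace ℝ (Fin d))) ⊆ suppM M ∧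
        (↑S : Set (EuclideanSpace ℝ (Fin d))).Pairwise
          (fun c c' => Disjoint (closedBall c r) (closedBall c' r)) ∧
        x = ∑ c ∈ S, M (closedBall c r) ^ q}) / Real.log r : ℝ) : EReal)) (𝓝[>] (0:ℝ))

/-- Legendre transform `τ^*(h) = inf_{q ∈ ℝ} (hq - τ(q))`. -/
def legendre (τ : ℝ → EReal) (h : ℝ) : EReal := ⨅ q : ℝ, ((h * q : ℝ) : EReal) - τ q

/-- Hausdorff dimension with the convention `dim_H ∅ = -∞`. -/
def dimHE {d : ℕ} (E : Set (EuclideanSpace ℝ (Fin d))) : EReal :=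
  @ite _ (E = ∅) (Classical.dec _) ⊥ ((dimH E : ℝ≥0∞) : EReal)

/-- Minimal number of open balls of radius `r` needed to cover `K`. -/
def coverNum {d : ℕ} (K : Set (EuclideanSpace ℝ (Fin d))) (r : ℝ) : ℕ :=
  sInf {n : ℕ | ∃ S : Finset (EuclideanSpace ℝ (Fin d)), S.card = n ∧ K ⊆ ⋃ c ∈ S, ball c r}

/-- Upper box (Minkowski) dimension. -/
def upperBoxDim {d : ℕ} (K : Set (EuclideanSpace ℝ (Fin d))) : EReal :=
  limsup (fun r : ℝ => ((Real.log (coverNum K r) / Real.log (1 / r) : ℝ) : EReal)) (𝓝[>] (0:ℝ))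

/-- A packing by closed balls of radius `r`. -/
def PackB {d : ℕ} (r : ℝ) (S : Finset (EuclideanSpace ℝ (Fin d))) : Prop :=
  (↑S : Set (EuclideanSpace ℝ (Fin d))).Pairwise
          (fun c c' => Disjoint (closedBall c r) (closedBall c' r))

def packSums {d : ℕ} (M : Set (EuclideanSpace ℝ (Fin d)) → ℝ) (q r : ℝ) : Set ℝ :=
  {x : ℝ | ∃ S : Finset (EuclideanSpace ℝ (Fin d)),
        (↑S : Set (EuclideanSpace ℝ (Fin d))) ⊆ suppM M ∧
        (↑S : Set (EuclideanSpace ℝ (Fin d))).Pairwise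
          (fun c c' => Disjoint (closedBall c r) (closedBall c' r)) ∧
        x = ∑ c ∈ S, M (closedBall c r) ^ q}

lemma pack_card_le {d : ℕ} {K : Set (EuclideanSpace ℝ (Fin d))} {r : ℝ}
    {S T : Finset (EuclideanSpace ℝ (Fin d))} (hS : (↑S : Set (EuclideanSpace ℝ (Fin d))) ⊆ K)
    (hp : PackB r S) (hT : K ⊆ ⋃ c ∈ T, ball c r) : S.card ≤ T.card := by
  have h1 : ∀ c : EuclideanSpace ℝ (Fin d), ∃ t, c ∈ S → (t ∈ T ∧ dist c t < r) := by
    intro c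
    by_cases hc : c ∈ S
    · have := hT (hS hc)
      simp only [mem_iUnion, mem_ball] at this
      obtain ⟨t, ht, h⟩ := this
      exact ⟨t, fun _ => ⟨ht, h⟩⟩
    · exact ⟨c, fun h => absurd h hc⟩
  choose f hf using h1
  refine Finset.card_le_card_of_injOn f (fun c hc => (hf c hc).1) ?_
  intro c hc c' hc' hcc
  by_contra hne
  have := hp hc hc' hne
  have e1 : f c ∈ closedBall c r := by
    rw [mem_closedBall, dist_comm]; exact (hf c hc).2.le
  have e2 : f c ∈ closedBall c' r := by
    rw [hcc, mem_closedBall, dist_comm]; exact (hf c' hc').2.le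
  exact Set.disjoint_left.1 this e1 e2

lemma exists_cover {d : ℕ} {K : Set (EuclideanSpace ℝ (Fin d))} (hK : IsCompact K) {r : ℝ}
    (hr : 0 < r) : ∃ T : Finset (EuclideanSpace ℝ (Fin d)),
      (↑T : Set (EuclideanSpace ℝ (Fin d))) ⊆ K ∧ K ⊆ ⋃ c ∈ T, ball c r := by
  obtain ⟨t, ht, hf, hc⟩ := finite_cover_balls_of_compact hK hr
  refine ⟨hf.toFinset, by simpa using ht, by simpa using hc⟩

lemma exists_max_pack {d : ℕ} {K G : Set (EuclideanSpace ℝ (Fin d))} (hK : IsCompact K)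
    (hG : G ⊆ K) {r : ℝ} (hr : 0 < r) : ∃ S : Finset (EuclideanSpace ℝ (Fin d)),
      (↑S : Set (EuclideanSpace ℝ (Fin d))) ⊆ G ∧ PackB r S ∧
        G ⊆ ⋃ c ∈ S, closedBall c (2 * r) := by
  classical
  obtain ⟨T, -, hT⟩ := exists_cover hK hr
  have h := Nat.sSup_mem (s := {n | ∃ S : Finset (EuclideanSpace ℝ (Fin d)),
      (↑S : Set (EuclideanSpace ℝ (Fin d))) ⊆ G ∧ PackB r S ∧ S.card = n})
      ⟨0, ∅, by simp, by simp [PackB], rfl⟩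
      ⟨T.card, by rintro n ⟨S, h1, h2, rfl⟩; exact pack_card_le (h1.trans hG) h2 hT⟩
  have hb : ∀ S : Finset (EuclideanSpace ℝ (Fin d)),
      (↑S : Set (EuclideanSpace ℝ (Fin d))) ⊆ G → PackB r S → S.card ≤
      sSup {n | ∃ S : Finset (EuclideanSpace ℝ (Fin d)),
      (↑S : Set (EuclideanSpace ℝ (Fin d))) ⊆ G ∧ PackB r S ∧ S.card = n} := by
    intro S h1 h2
    refine le_csSup ⟨T.card, ?_⟩ ⟨S, h1, h2, rfl⟩
    rintro n ⟨S, h1, h2, rfl⟩; exact pack_card_le (h1.trans hG) h2 hT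
  obtain ⟨S, h1, h2, h3⟩ := h
  refine ⟨S, h1, h2, ?_⟩
  intro t ht
  by_contra hcon
  simp only [mem_iUnion, not_exists, mem_closedBall, not_le] at hcon
  have hd : ∀ c ∈ S, Disjoint (closedBall t r) (closedBall c r) := by
    intro c hc
    refine closedBall_disjoint_closedBall ?_
    linarith [hcon c hc]
  have htS : t ∉ S := fun h => by
    have := hcon t h
    simp at this
    linarith
  have := hb (insert t S) (by
    intro x hx
    simp only [Finset.coe_insert, mem_insert_iff] at hx
    rcases hx with rfl | hx
    · exact ht
    · exact h1 hx) (by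
    unfold PackB
    rw [Finset.coe_insert]
    refine Set.Pairwise.insert h2 ?_
    intro c hc _
    exact ⟨hd c hc, (hd c hc).symm⟩)
  rw [Finset.card_insert_of_notMem htS, h3] at this
  omega

section
variable {d : ℕ} {M : Set (EuclideanSpace ℝ (Fin d)) → ℝ}

lemma M_pos (hmono : ∀ A B : Set (EuclideanSpace ℝ (Fin d)), A ⊆ B → M A ≤ M B)
    {c : EuclideanSpace ℝ (Fin d)} (hc : c ∈ suppM M) {r : ℝ} (hr : 0 < r) :
    0 < M (closedBall c r) := (hc r hr).trans_le (hmono _ _ ball_subset_closedBall)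

lemma pow_bdd (hnonneg : ∀ A, 0 ≤ M A) (hbdd : ∃ C : ℝ, ∀ A, M A ≤ C)
    (hmono : ∀ A B : Set (EuclideanSpace ℝ (Fin d)), A ⊆ B → M A ≤ M B)
    (hcomp : IsCompact (suppM M)) (q : ℝ) {r : ℝ} (hr : 0 < r) :
    ∃ B, 0 ≤ B ∧ ∀ c ∈ suppM M, M (closedBall c r) ^ q ≤ B := by
  rcases le_total 0 q with hq | hq
  · obtain ⟨C, hC⟩ := hbdd
    have hC0 : 0 ≤ C := (hnonneg ∅).trans (hC ∅)
    exact ⟨C ^ q, Real.rpow_nonneg hC0 _, fun c _ => Real.rpow_le_rpow (hnonneg _) (hC _) hq⟩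
  · obtain ⟨T, hT, hcov⟩ := exists_cover hcomp (half_pos hr)
    refine ⟨∑ x ∈ T, M (ball x (r/2)) ^ q,
      Finset.sum_nonneg fun x _ => Real.rpow_nonneg (hnonneg _) _, fun c hc => ?_⟩
    have := hcov hc
    simp only [mem_iUnion, mem_ball] at this
    obtain ⟨x, hx, hcx⟩ := this
    refine le_trans ?_ (Finset.single_le_sum (f := fun x => M (ball x (r/2)) ^ q)
      (fun x _ => Real.rpow_nonneg (hnonneg _) _) hx)
    refine Real.rpow_le_rpow_of_nonpos (hT hx _ (half_pos hr)) (hmono _ _ ?_) hq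
    intro y hy
    rw [mem_ball] at hy
    rw [mem_closedBall]
    have := dist_triangle_right y c x
    linarith

lemma packSums_bdd (hnonneg : ∀ A, 0 ≤ M A) (hbdd : ∃ C : ℝ, ∀ A, M A ≤ C)
    (hmono : ∀ A B : Set (EuclideanSpace ℝ (Fin d)), A ⊆ B → M A ≤ M B)
    (hcomp : IsCompact (suppM M)) (q : ℝ) {r : ℝ} (hr : 0 < r) :
    BddAbove (packSums M q r) := by
  obtain ⟨B, hB0, hB⟩ := pow_bdd hnonneg hbdd hmono hcomp q hr
  obtain ⟨T, hT, hcov⟩ := exists_cover hcomp hr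
  refine ⟨T.card * B, ?_⟩
  rintro x ⟨S, h1, h2, rfl⟩
  calc _ ≤ ∑ c ∈ S, B := Finset.sum_le_sum fun c hc => hB c (h1 hc)
    _ = S.card * B := by simp
    _ ≤ _ := by
      exact mul_le_mul_of_nonneg_right (Nat.cast_le.2 (pack_card_le h1 h2 hcov)) hB0

lemma packSums_pos (hnonneg : ∀ A, 0 ≤ M A) (hbdd : ∃ C : ℝ, ∀ A, M A ≤ C)
    (hmono : ∀ A B : Set (EuclideanSpace ℝ (Fin d)), A ⊆ B → M A ≤ M B)
    (hne : (suppM M).Nonempty)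
    (hcomp : IsCompact (suppM M)) (q : ℝ) {r : ℝ} (hr : 0 < r) :
    0 < sSup (packSums M q r) := by
  obtain ⟨c, hc⟩ := hne
  refine (Real.rpow_pos_of_pos (M_pos hmono hc hr) q).trans_le
    (le_csSup (packSums_bdd hnonneg hbdd hmono hcomp q hr) ⟨{c}, ?_, ?_, ?_⟩)
  · simpa using hc
  · simp
  · simp

lemma tauM_eq (q : ℝ) : tauM M q = liminf (fun r : ℝ =>
    ((Real.log (sSup (packSums M q r)) / Real.log r : ℝ) : EReal)) (𝓝[>] (0:ℝ)) := rfl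

/-- Packing number versus covering number. -/
lemma pack_le_cover (hcomp : IsCompact (suppM M)) {r : ℝ} (hr : 0 < r) :
    sSup (packSums M 0 r) ≤ coverNum (suppM M) r := by
  have h := Nat.sInf_mem (s := {n : ℕ | ∃ S : Finset (EuclideanSpace ℝ (Fin d)), S.card = n ∧
    suppM M ⊆ ⋃ c ∈ S, ball c r}) (by
      obtain ⟨T, -, hT⟩ := exists_cover hcomp hr
      exact ⟨_, T, rfl, hT⟩)
  obtain ⟨T, h1, h2⟩ := h
  refine Real.sSup_le ?_ (by positivity)
  rintro x ⟨S, h3, h4, rfl⟩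
  simp only [Real.rpow_zero, Finset.sum_const, nsmul_eq_mul, mul_one, Nat.cast_le]
  exact (pack_card_le h3 h4 h2).trans h1.le

lemma cover_le_pack (hnonneg : ∀ A, 0 ≤ M A) (hbdd : ∃ C : ℝ, ∀ A, M A ≤ C)
    (hmono : ∀ A B : Set (EuclideanSpace ℝ (Fin d)), A ⊆ B → M A ≤ M B)
    (hcomp : IsCompact (suppM M)) {r : ℝ} (hr : 0 < r) :
    coverNum (suppM M) (3 * r) ≤ sSup (packSums M 0 r) := by
  obtain ⟨S, h1, h2, h3⟩ := exists_max_pack hcomp subset_rfl hr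
  have : (coverNum (suppM M) (3 * r) : ℝ) ≤ S.card := by
    refine Nat.cast_le.2 (Nat.sInf_le ⟨S, rfl, h3.trans ?_⟩)
    refine iUnion₂_mono fun c _ => closedBall_subset_ball (by linarith)
  refine this.trans (le_csSup (packSums_bdd hnonneg hbdd hmono hcomp 0 hr) ⟨S, h1, h2, by simp⟩)

lemma part1 (hnonneg : ∀ A, 0 ≤ M A) (hbdd : ∃ C : ℝ, ∀ A, M A ≤ C)
    (hmono : ∀ A B : Set (EuclideanSpace ℝ (Fin d)), A ⊆ B → M A ≤ M B)
    (hne : (suppM M).Nonempty)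
    (hcomp : IsCompact (suppM M)) : upperBoxDim (suppM M) = - tauM M 0 := by
  have h01 : ∀ᶠ r : ℝ in 𝓝[>] (0:ℝ), 0 < r ∧ r < 1 :=
    Ioo_mem_nhdsGT one_pos
  rw [tauM_eq, ← EReal.limsup_neg, upperBoxDim]
  have hpos : ∀ r : ℝ, 0 < r → 0 < sSup (packSums M 0 r) :=
    fun r hr => packSums_pos hnonneg hbdd hmono hne hcomp 0 hr
  apply le_antisymm
  · rw [← EReal.le_of_forall_lt_iff_le]
    intro z hz
    obtain ⟨c, hc1, hc2⟩ := EReal.lt_iff_exists_real_btwn.1 hz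
    have hcz : c < z := by exact_mod_cast hc2
    have h1 := eventually_lt_of_limsup_lt hc1
    have ht3 : Tendsto (fun r : ℝ => r / 3) (𝓝[>] (0:ℝ)) (𝓝[>] (0:ℝ)) := by
      refine tendsto_nhdsWithin_iff.2 ⟨?_, ?_⟩
      · have : Tendsto (fun r : ℝ => r / 3) (𝓝 (0:ℝ)) (𝓝 (0 / 3)) := tendsto_id.div_const 3
        rw [zero_div] at this
        exact this.mono_left nhdsWithin_le_nhds
      · filter_upwards [self_mem_nhdsWithin] with r hr
        have : (0:ℝ) < r := hr
        show (0:ℝ) < r / 3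
        positivity
    have h2 := ht3.eventually h1
    have hlog : Tendsto (fun r : ℝ => (z - c) * (- Real.log r)) (𝓝[>] (0:ℝ)) atTop :=
      Tendsto.const_mul_atTop (by linarith)
        (tendsto_neg_atBot_atTop.comp Real.tendsto_log_nhdsGT_zero)
    refine limsup_le_of_le (h := ?_)
    filter_upwards [h01, h2, hlog.eventually_ge_atTop (c * Real.log 3)] with r hr h4 h5
    obtain ⟨hr0, hr1⟩ := hr
    have hlr : Real.log r < 0 := Real.log_neg hr0 hr1
    have hlr3 : Real.log (r / 3) < 0 := Real.log_neg (by positivity) (by linarith)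
    have h6 : -(Real.log (sSup (packSums M 0 (r/3))) / Real.log (r/3)) < c := by
      have h7 := h4
      simp only [Pi.neg_apply] at h7
      exact_mod_cast h7
    have h8 := cover_le_pack hnonneg hbdd hmono hcomp (r := r / 3) (by positivity)
    rw [mul_div_cancel₀ r (by norm_num : (3:ℝ) ≠ 0)] at h8
    have h9 : Real.log (coverNum (suppM M) r) ≤ Real.log (sSup (packSums M 0 (r/3))) :=
      Real.log_le_log ((hpos r hr0).trans_le (pack_le_cover hcomp hr0)) h8
    rw [← div_neg, div_lt_iff₀ (by linarith), Real.log_div hr0.ne' (by norm_num)] at h6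
    rw [EReal.coe_le_coe_iff, one_div, Real.log_inv, div_le_iff₀ (by linarith)]
    nlinarith
  · refine limsup_le_limsup ?_
    filter_upwards [h01] with r hr
    obtain ⟨hr0, hr1⟩ := hr
    have hlr : Real.log r < 0 := Real.log_neg hr0 hr1
    simp only [Pi.neg_apply]
    rw [← EReal.coe_neg, EReal.coe_le_coe_iff, one_div, Real.log_inv, ← div_neg]
    have : 0 < -Real.log r := by linarith
    gcongr
    · exact hpos r hr0
    · exact pack_le_cover hcomp hr0

def goodSet (M : Set (EuclideanSpace ℝ (Fin d)) → ℝ) (q a : ℝ) (n : ℕ) :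
    Set (EuclideanSpace ℝ (Fin d)) :=
  {t | t ∈ suppM M ∧ -(n * Real.log 2) * a ≤ q * Real.log (M (closedBall t ((1/2:ℝ)^n)))}

lemma log_half_pow (n : ℕ) : Real.log ((1/2:ℝ)^n) = -(n * Real.log 2) := by
  rw [Real.log_pow, one_div, Real.log_inv]; ring

lemma tendsto_half_pow : Tendsto (fun n : ℕ => (1/2:ℝ)^n) atTop (𝓝[>] (0:ℝ)) :=
  tendsto_nhdsWithin_iff.2 ⟨tendsto_pow_atTop_nhds_zero_of_lt_one (by norm_num) (by norm_num),
    Eventually.of_forall fun n => by show (0:ℝ) < _; positivity⟩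

lemma exists_eps (q x y : ℝ) (hxy : x < y) : ∃ ε > 0, x + ε * q < y := by
  refine ⟨(y - x) / (2 * (|q| + 1)), div_pos (by linarith) (by positivity), ?_⟩
  have h1 : (y - x) / (2 * (|q| + 1)) * q ≤ (y - x) / (2 * (|q| + 1)) * (|q| + 1) := by
    have : 0 < (y - x) / (2 * (|q| + 1)) := div_pos (by linarith) (by positivity)
    have := le_abs_self q
    gcongr
    linarith
  have h2 : (y - x) / (2 * (|q| + 1)) * (|q| + 1) = (y - x) / 2 := by
    have : |q| + 1 ≠ 0 := by positivity
    field_simp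
  linarith

lemma freq_good (hmono : ∀ A B : Set (EuclideanSpace ℝ (Fin d)), A ⊆ B → M A ≤ M B)
    {h : ℝ} (hh : 0 ≤ h) {t : EuclideanSpace ℝ (Fin d)} (ht : t ∈ suppM M)
    (hl : liminf (fun r : ℝ => ((Real.log (M (ball t r)) / Real.log r : ℝ) : EReal))
            (𝓝[>] (0:ℝ)) = (h : EReal)) {q a : ℝ} (ha : h * q < a) :
    ∃ᶠ n : ℕ in atTop, t ∈ goodSet M q a n := by
  have hlog2 : 0 < Real.log 2 := Real.log_pos (by norm_num)
  have h01 : ∀ᶠ r : ℝ in 𝓝[>] (0:ℝ), 0 < r ∧ r < 1 := Ioo_mem_nhdsGT one_pos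
  rcases le_total 0 q with hq | hq
  · obtain ⟨ε, hε, hε'⟩ := exists_eps q _ _ ha
    have hf : ∃ᶠ r : ℝ in 𝓝[>] (0:ℝ),
        ((Real.log (M (ball t r)) / Real.log r : ℝ) : EReal) < ((h + ε : ℝ) : EReal) := by
      refine frequently_lt_of_liminf_lt (h := ?_)
      rw [hl]
      exact_mod_cast (by linarith : h < h + ε)
    rw [frequently_atTop]
    intro N
    obtain ⟨N₁, hN₁⟩ := exists_nat_ge (q * (h + ε) / (a - q * (h + ε)))
    have hsmall : ∀ᶠ r : ℝ in 𝓝[>] (0:ℝ), 0 < r ∧ r < (1/2:ℝ)^(max N N₁) :=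
      Ioo_mem_nhdsGT (by positivity)
    obtain ⟨r, hr, ⟨hr0, hr1⟩, -, hr2⟩ := (hf.and_eventually (h01.and hsmall)).exists
    obtain ⟨n, hn1, hn2⟩ := exists_nat_pow_near_of_lt_one hr0 hr1.le
      (by norm_num : (0:ℝ) < 1/2) (by norm_num)
    have hn : max N N₁ ≤ n := by
      by_contra hcon
      have : (1/2:ℝ)^(max N N₁) ≤ (1/2:ℝ)^(n+1) :=
        pow_le_pow_of_le_one (by norm_num) (by norm_num) (by omega)
      linarith
    refine ⟨n, (le_max_left _ _).trans hn, ht, ?_⟩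
    have hlr : Real.log r < 0 := Real.log_neg hr0 hr1
    have hr' : Real.log (M (ball t r)) / Real.log r < h + ε := by exact_mod_cast hr
    rw [div_lt_iff_of_neg hlr] at hr'
    have h1 : Real.log (M (ball t r)) ≤ Real.log (M (closedBall t ((1/2:ℝ)^n))) :=
      Real.log_le_log (ht r hr0) (hmono _ _ (ball_subset_closedBall.trans
        (closedBall_subset_closedBall hn2)))
    have h2 : -((n + 1 : ℕ) * Real.log 2) ≤ Real.log r := by
      rw [← log_half_pow]
      exact Real.log_le_log (by positivity) hn1.le
    push_cast at h2
    have h3 : (h + ε) * (-((n + 1) * Real.log 2)) ≤ Real.log (M (closedBall t ((1/2:ℝ)^n))) := by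
      have := mul_le_mul_of_nonneg_left h2 (by linarith : 0 ≤ h + ε)
      linarith
    have h4 := mul_le_mul_of_nonneg_left h3 hq
    refine le_trans ?_ h4
    have hN2 : (N₁ : ℝ) ≤ n := by exact_mod_cast (le_max_right _ _).trans hn
    have h5 := hN₁.trans hN2
    rw [div_le_iff₀ (by linarith)] at h5
    nlinarith
  · refine Eventually.frequently ?_
    obtain ⟨ε, hε, hε'⟩ := exists_eps (-q) _ _ ha
    have hf : ∀ᶠ r : ℝ in 𝓝[>] (0:ℝ),
        ((h - ε : ℝ) : EReal) < ((Real.log (M (ball t r)) / Real.log r : ℝ) : EReal) := by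
      refine eventually_lt_of_lt_liminf ?_
      rw [hl]
      exact_mod_cast (by linarith : h - ε < h)
    have h2 := tendsto_half_pow.eventually (hf.and h01)
    rw [← map_add_atTop_eq_nat 1, eventually_map]
    obtain ⟨N₁, hN₁⟩ := exists_nat_ge (-a / (a - q * (h - ε)))
    filter_upwards [h2, eventually_ge_atTop N₁] with n hn hnN
    obtain ⟨h3, h4, h5⟩ := hn
    refine ⟨ht, ?_⟩
    have hlr : Real.log ((1/2:ℝ)^n) < 0 := Real.log_neg h4 h5
    have h3' : h - ε < Real.log (M (ball t ((1/2:ℝ)^n))) / Real.log ((1/2:ℝ)^n) := by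
      exact_mod_cast h3
    rw [lt_div_iff_of_neg hlr, log_half_pow] at h3'
    have h6 : Real.log (M (closedBall t ((1/2:ℝ)^(n+1)))) ≤ Real.log (M (ball t ((1/2:ℝ)^n))) := by
      refine Real.log_le_log (M_pos hmono ht (by positivity)) (hmono _ _ ?_)
      refine closedBall_subset_ball ?_
      rw [pow_succ]
      linarith
    have h7 := mul_le_mul_of_nonpos_left (h6.trans h3'.le) hq
    refine le_trans ?_ h7
    have hN2 : (N₁ : ℝ) ≤ n := by exact_mod_cast hnN
    have h8 := hN₁.trans hN2
    rw [div_le_iff₀ (by linarith)] at h8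
    push_cast
    nlinarith

lemma good_cover (hnonneg : ∀ A, 0 ≤ M A) (hbdd : ∃ C : ℝ, ∀ A, M A ≤ C)
    (hmono : ∀ A B : Set (EuclideanSpace ℝ (Fin d)), A ⊆ B → M A ≤ M B)
    (hne : (suppM M).Nonempty) (hcomp : IsCompact (suppM M)) {q b : ℝ} (a : ℝ)
    (hb : (b : EReal) < tauM M q) :
    ∀ᶠ n : ℕ in atTop, ∃ S : Finset (EuclideanSpace ℝ (Fin d)),
      (S.card : ℝ) ≤ Real.exp (n * Real.log 2 * (a - b)) ∧
      goodSet M q a n ⊆ ⋃ c ∈ S, closedBall c (2 * (1/2:ℝ)^n) := by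
  have h01 : ∀ᶠ r : ℝ in 𝓝[>] (0:ℝ), 0 < r ∧ r < 1 := Ioo_mem_nhdsGT one_pos
  rw [tauM_eq] at hb
  filter_upwards [tendsto_half_pow.eventually ((eventually_lt_of_lt_liminf hb).and h01)]
    with n hn
  obtain ⟨h1, h2, h3⟩ := hn
  have hlr : Real.log ((1/2:ℝ)^n) < 0 := Real.log_neg h2 h3
  have h1' : b < Real.log (sSup (packSums M q ((1/2:ℝ)^n))) / Real.log ((1/2:ℝ)^n) := by
    exact_mod_cast h1
  rw [lt_div_iff_of_neg hlr, log_half_pow,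
    Real.log_lt_iff_lt_exp (packSums_pos hnonneg hbdd hmono hne hcomp q h2)] at h1'
  obtain ⟨S, hS1, hS2, hS3⟩ := exists_max_pack (G := goodSet M q a n) hcomp (fun t ht => ht.1) h2
  refine ⟨S, ?_, hS3⟩
  have h4 := le_csSup (packSums_bdd hnonneg hbdd hmono hcomp q h2)
    ⟨S, hS1.trans (fun t ht => ht.1), hS2, rfl⟩
  have h5 : S.card * Real.exp (-(n * Real.log 2) * a) ≤
      ∑ c ∈ S, M (closedBall c ((1/2:ℝ)^n)) ^ q := by
    rw [← nsmul_eq_mul]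
    refine Finset.card_nsmul_le_sum _ _ _ fun c hc => ?_
    rw [Real.rpow_def_of_pos (M_pos hmono (hS1 hc).1 h2), Real.exp_le_exp, mul_comm (Real.log _)]
    exact (hS1 hc).2
  have h6 := (h5.trans h4).trans h1'.le
  rw [← le_div_iff₀ (Real.exp_pos _), ← Real.exp_sub] at h6
  refine h6.trans (le_of_eq ?_)
  congr 1
  ring

lemma dim_limsup {G : ℕ → Set (EuclideanSpace ℝ (Fin d))} {E : Set (EuclideanSpace ℝ (Fin d))}
    (hE : ∀ t ∈ E, ∃ᶠ n in atTop, t ∈ G n) {u s : ℝ} (hus : u < s)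
    (hG : ∀ᶠ n : ℕ in atTop, ∃ S : Finset (EuclideanSpace ℝ (Fin d)),
      (S.card : ℝ) ≤ Real.exp (n * Real.log 2 * u) ∧
      G n ⊆ ⋃ c ∈ S, closedBall c (2 * (1/2:ℝ)^n)) : dimHE E ≤ s := by
  have hlog2 : 0 < Real.log 2 := Real.log_pos (by norm_num)
  unfold dimHE
  split_ifs with hem
  · exact bot_le
  rcases lt_or_ge s 0 with hs | hs
  · exfalso
    obtain ⟨t, ht⟩ := Set.nonempty_iff_ne_empty.2 hem
    obtain ⟨n, h1, ⟨S, h2, h3⟩, h4⟩ :=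
      ((hE t ht).and_eventually (hG.and (eventually_gt_atTop 0))).exists
    have h5 : Real.exp (n * Real.log 2 * u) < 1 := by
      rw [Real.exp_lt_one_iff]
      have : (0:ℝ) < n := by exact_mod_cast h4
      exact mul_neg_of_pos_of_neg (by positivity) (by linarith)
    have h6 : S.card < 1 := by exact_mod_cast h2.trans_lt h5
    have h7 : S = ∅ := by simpa using h6
    have := h3 h1
    simp [h7] at this
  · obtain ⟨N, hN⟩ := eventually_atTop.1 hG
    have hG' : ∀ n : ℕ, ∃ S : Finset (EuclideanSpace ℝ (Fin d)), N ≤ n →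
      ((S.card : ℝ) ≤ Real.exp (n * Real.log 2 * u) ∧
      G n ⊆ ⋃ c ∈ S, closedBall c (2 * (1/2:ℝ)^n)) := by
      intro n
      by_cases h : N ≤ n
      · obtain ⟨S, hS⟩ := hN n h
        exact ⟨S, fun _ => hS⟩
      · exact ⟨∅, fun h' => absurd h' h⟩
    choose S hS using hG'
    lift s to ℝ≥0 using hs
    -- real summable majorant
    let f : ℕ → ℝ := fun n => (4:ℝ)^(s:ℝ) * (Real.exp (Real.log 2 * (u - s)))^n
    have hf : Summable f := by
      refine Summable.mul_left _ (summable_geometric_of_lt_one (Real.exp_pos _).le ?_)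
      rw [Real.exp_lt_one_iff]
      exact mul_neg_of_pos_of_neg hlog2 (by linarith)
    have hf0 : ∀ n, 0 ≤ f n := fun n => by positivity
    have hf' : ∑' n, ENNReal.ofReal (f n) ≠ ⊤ := hf.tsum_ofReal_ne_top
    have hdiam : ∀ (n : ℕ) (c : EuclideanSpace ℝ (Fin d)),
        ediam (closedBall c (2 * (1/2:ℝ)^n)) ≤ ENNReal.ofReal (4 * (1/2:ℝ)^n) := by
      intro n c
      refine ediam_le_of_forall_dist_le fun x hx y hy => ?_
      rw [mem_closedBall] at hx hy
      have := dist_triangle_right x y c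
      linarith
    have hterm : ∀ n, N ≤ n → ((S n).card : ℝ≥0∞) * (ENNReal.ofReal (4 * (1/2:ℝ)^n))^(s:ℝ)
        ≤ ENNReal.ofReal (f n) := by
      intro n hn
      rw [ENNReal.ofReal_rpow_of_nonneg (by positivity) s.coe_nonneg, ← ENNReal.ofReal_natCast,
        ← ENNReal.ofReal_mul (by positivity)]
      refine ENNReal.ofReal_le_ofReal ?_
      refine (mul_le_mul_of_nonneg_right (hS n hn).1 (by positivity)).trans (le_of_eq ?_)
      rw [Real.mul_rpow (by norm_num) (by positivity),
        Real.rpow_def_of_pos (by positivity : (0:ℝ) < (1/2:ℝ)^n), log_half_pow]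
      simp only [f]
      rw [← Real.exp_nat_mul, mul_left_comm, ← Real.exp_add]
      congr 2
      ring
    have key := Measure.hausdorffMeasure_le_liminf_tsum (X := EuclideanSpace ℝ (Fin d))
      (ι := fun m : ℕ => Σ k : ℕ, (S (k + m))) (s:ℝ) E (l := atTop)
      (fun m => ENNReal.ofReal (4 * (1/2:ℝ)^m)) (by
        have h1 : Tendsto (fun m : ℕ => 4 * (1/2:ℝ)^m) atTop (𝓝 (4 * 0)) :=
          (tendsto_pow_atTop_nhds_zero_of_lt_one (by norm_num) (by norm_num)).const_mul 4
        have h2 := ENNReal.tendsto_ofReal h1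
        simpa using h2)
      (fun m i => closedBall (i.2 : EuclideanSpace ℝ (Fin d)) (2 * (1/2:ℝ)^(i.1 + m)))
      (Eventually.of_forall fun m i => (hdiam _ _).trans (ENNReal.ofReal_le_ofReal (by
        have : (1/2:ℝ)^(i.1 + m) ≤ (1/2:ℝ)^m :=
          pow_le_pow_of_le_one (by norm_num) (by norm_num) (by omega)
        linarith)))
      (by
        filter_upwards [eventually_ge_atTop N] with m hm
        intro t ht
        obtain ⟨n, hn, htn⟩ := frequently_atTop.1 (hE t ht) m
        have := (hS n (hm.trans hn)).2 htn
        simp only [mem_iUnion] at this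
        obtain ⟨c, hc, htc⟩ := this
        obtain ⟨k, rfl⟩ := Nat.exists_eq_add_of_le' hn
        exact mem_iUnion.2 ⟨⟨k, c, hc⟩, htc⟩)
    have hzero : (Measure.hausdorffMeasure (s:ℝ)) E ≤ 0 := by
      refine key.trans ?_
      have h1 := ENNReal.tendsto_sum_nat_add _ hf'
      rw [← h1.liminf_eq]
      refine liminf_le_liminf ?_
      filter_upwards [eventually_ge_atTop N] with m hm
      rw [ENNReal.tsum_sigma (fun k (i : S (k + m)) =>
        ediam (closedBall (i : EuclideanSpace ℝ (Fin d)) (2 * (1/2:ℝ)^(k + m))) ^ (s:ℝ))]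
      refine ENNReal.tsum_le_tsum fun k => ?_
      refine le_trans ?_ (hterm (k + m) (by omega))
      rw [tsum_fintype]
      refine (Finset.sum_le_card_nsmul (Finset.univ : Finset (S (k + m))) _
        ((ENNReal.ofReal (4 * (1/2:ℝ)^(k + m)))^(s:ℝ)) fun (i : S (k + m)) _ =>
        ENNReal.rpow_le_rpow (hdiam (k + m) (i : EuclideanSpace ℝ (Fin d)))
          s.coe_nonneg).trans ?_
      simp
    have hd : dimH E ≤ s := dimH_le_of_hausdorffMeasure_ne_top
      (ne_top_of_le_ne_top ENNReal.zero_ne_top hzero)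
    exact EReal.coe_ennreal_le_coe_ennreal_iff.2 hd
end

/-- For a non-negative, bounded, non-decreasing set function `M` on `ℝ^d`
with non-empty compact support, the upper box dimension of `supp(M)` is `-τ_M(0)` and for
every `h ≥ 0`, `dim_H {t ∈ supp(M) : liminf log M(B(t,r))/log r = h} ≤ τ_M^*(h)`, a negative
right-hand side meaning the set is empty (convention `dim_H ∅ = -∞`). -/
theorem statement1 (d : ℕ) (M : Set (EuclideanSpace ℝ (Fin d)) → ℝ)
    (hnonneg : ∀ A, 0 ≤ M A) (hbdd : ∃ C : ℝ, ∀ A, M A ≤ C)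
    (hmono : ∀ A B : Set (EuclideanSpace ℝ (Fin d)), A ⊆ B → M A ≤ M B)
    (hne : (suppM M).Nonempty) (hcomp : IsCompact (suppM M)) :
    upperBoxDim (suppM M) = - tauM M 0 ∧
    ∀ h : ℝ, 0 ≤ h →
      dimHE {t ∈ suppM M |
          liminf (fun r : ℝ => ((Real.log (M (ball t r)) / Real.log r : ℝ) : EReal))
            (𝓝[>] (0:ℝ)) = (h : EReal)}
        ≤ legendre (tauM M) h := by
  refine ⟨part1 hnonneg hbdd hmono hne hcomp, fun h hh => le_iInf fun q => ?_⟩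
  rw [← EReal.le_of_forall_lt_iff_le]
  intro s hs
  have hb : ((h * q - s : ℝ) : EReal) < tauM M q := by
    induction hτ : tauM M q with
    | bot => rw [hτ, EReal.coe_sub_bot] at hs; exact absurd hs not_top_lt
    | top => exact EReal.coe_lt_top _
    | coe x =>
      rw [hτ] at hs
      have hs' : h * q - x < s := by exact_mod_cast hs
      exact_mod_cast (by linarith : h * q - s < x)
  obtain ⟨b, hb1, hb2⟩ := EReal.lt_iff_exists_real_btwn.1 hb
  have hb1' : h * q - s < b := by exact_mod_cast hb1
  obtain ⟨a, ha1, ha2⟩ := exists_between (by linarith : h * q < b + s)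
  exact dim_limsup (G := goodSet M q a) (u := a - b)
    (fun t ht => freq_good hmono hh ht.1 ht.2 ha1) (by linarith)
    (good_cover hnonneg hbdd hmono hne hcomp a hb2)
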